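/- arXiv:hep-th/9301063 — 4 statements merged into one kernel-verified Lean document; each statement's English description precedes it below -/
import Mathlib

section
/- Let X be a complex Banach space. Then there exists a commutative unital complex Banach algebra S_bX together with a contraction ι : X → S_bX such that: (i) for every commutative unital complex Banach algebra A and every contraction F : X → A, there is a unique unital algebra homomorphism F̃ : S_bX → A satisfying ‖F̃(a)‖ ≤ ‖a‖ for all a ∈ S_bX and F = F̃ ∘ ι; and (ii) the unital subalgebra of S_bX generated by ι(X) is dense in S_bX, and the canonical unital algebra homomorphism from the symmetric algebra SX to S_bX extending ι is injective. -/
noncomputable section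

/-- The relation on the tensor algebra imposing commutativity of multiplication. -/
inductive SymRel (X : Type) [AddCommGroup X] [Module ℂ X] :
    TensorAlgebra ℂ X → TensorAlgebra ℂ X → Prop
  | mul_comm (a b : TensorAlgebra ℂ X) : SymRel X (a * b) (b * a)

/-- The symmetric algebra of a complex vector space `X`: the free commutative
unital complex algebra on `X`. -/
abbrev SymmAlgebra (X : Type) [AddCommGroup X] [Module ℂ X] : Type :=
  RingQuot (SymRel X)

instance (X : Type) [AddCommGroup X] [Module ℂ X] : CommRing (SymmAlgebra X) :=
  { (inferInstance : Ring (SymmAlgebra X)) with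
    mul_comm := by
      intro a b
      obtain ⟨a, rfl⟩ := RingQuot.mkRingHom_surjective (SymRel X) a
      obtain ⟨b, rfl⟩ := RingQuot.mkRingHom_surjective (SymRel X) b
      rw [← map_mul, ← map_mul]
      exact RingQuot.mkRingHom_rel (SymRel.mul_comm a b) }

/-- The canonical linear inclusion of `X` into its symmetric algebra. -/
def SymmAlgebra.ι (X : Type) [AddCommGroup X] [Module ℂ X] : X →ₗ[ℂ] SymmAlgebra X :=
  (RingQuot.mkAlgHom ℂ (SymRel X)).toLinearMap ∘ₗ TensorAlgebra.ι ℂ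

namespace BanachSym

/-- Admissible algebra seminorms on `S` for a linear map `j : X → S`. -/
structure Adm {X : Type} [NormedAddCommGroup X] [NormedSpace ℂ X]
    {S : Type} [CommRing S] [Algebra ℂ S] (j : X →ₗ[ℂ] S) (q : S → ℝ) : Prop where
  nonneg : ∀ a, 0 ≤ q a
  zero : q 0 = 0
  add : ∀ a b, q (a + b) ≤ q a + q b
  mul : ∀ a b, q (a * b) ≤ q a * q b
  smul : ∀ (c : ℂ) a, q (c • a) ≤ ‖c‖ * q a
  one : q 1 ≤ 1
  gen : ∀ x, q (j x) ≤ ‖x‖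

section
variable {X : Type} [NormedAddCommGroup X] [NormedSpace ℂ X]
    {S : Type} [CommRing S] [Algebra ℂ S] (j : X →ₗ[ℂ] S)

lemma adm_of_hom {A : Type} [NormedCommRing A] [NormedAlgebra ℂ A] [NormOneClass A]
    (G : S →ₐ[ℂ] A) (hG : ∀ x, ‖G (j x)‖ ≤ ‖x‖) : Adm j (fun s => ‖G s‖) where
  nonneg a := norm_nonneg _
  zero := by simp
  add a b := by simpa using norm_add_le (G a) (G b)
  mul a b := by simpa using norm_mul_le (G a) (G b)
  smul c a := by simp [norm_smul]
  one := by simp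
  gen := hG

lemma adm_bdd (hgen : Algebra.adjoin ℂ (Set.range j) = ⊤) (s : S) :
    ∃ C : ℝ, ∀ q, Adm j q → q s ≤ C := by
  have hs : s ∈ Algebra.adjoin ℂ (Set.range j) := by rw [hgen]; trivial
  induction hs using Algebra.adjoin_induction with
  | mem x hx =>
    obtain ⟨x, rfl⟩ := hx
    exact ⟨‖x‖, fun q hq => hq.gen x⟩
  | algebraMap r =>
    refine ⟨‖r‖, fun q hq => ?_⟩
    rw [Algebra.algebraMap_eq_smul_one]
    exact (hq.smul r 1).trans (mul_le_of_le_one_right (norm_nonneg _) hq.one)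
  | add x y _ _ hx hy =>
    obtain ⟨C, hC⟩ := hx
    obtain ⟨D, hD⟩ := hy
    exact ⟨C + D, fun q hq => (hq.add x y).trans (add_le_add (hC q hq) (hD q hq))⟩
  | mul x y _ _ hx hy =>
    obtain ⟨C, hC⟩ := hx
    obtain ⟨D, hD⟩ := hy
    exact ⟨C * D, fun q hq => (hq.mul x y).trans
      (mul_le_mul (hC q hq) (hD q hq) (hq.nonneg _) ((hq.nonneg _).trans (hC q hq)))⟩

/-- The largest admissible seminorm. -/
lemma exists_max_adm (hgen : Algebra.adjoin ℂ (Set.range j) = ⊤) (q₀ : S → ℝ) (hq₀ : Adm j q₀) :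
    ∃ p : S → ℝ, Adm j p ∧ ∀ q, Adm j q → ∀ s, q s ≤ p s := by
  haveI : Nonempty {q // Adm j q} := ⟨⟨q₀, hq₀⟩⟩
  have bdd : ∀ s, BddAbove (Set.range fun q : {q // Adm j q} => q.1 s) := by
    intro s
    obtain ⟨C, hC⟩ := adm_bdd j hgen s
    exact ⟨C, by rintro _ ⟨q, rfl⟩; exact hC q.1 q.2⟩
  have le : ∀ s (q : {q // Adm j q}), q.1 s ≤ ⨆ q : {q // Adm j q}, q.1 s :=
    fun s q => le_ciSup (bdd s) q
  have nn : ∀ s, 0 ≤ ⨆ q : {q // Adm j q}, q.1 s :=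
    fun s => (hq₀.nonneg s).trans (le s ⟨q₀, hq₀⟩)
  refine ⟨fun s => ⨆ q : {q // Adm j q}, q.1 s, ⟨nn, ?_, ?_, ?_, ?_, ?_, ?_⟩,
    fun q hq s => le s ⟨q, hq⟩⟩
  · exact le_antisymm (ciSup_le fun q => q.2.zero.le) (nn 0)
  · exact fun a b => ciSup_le fun q => (q.2.add a b).trans (add_le_add (le a q) (le b q))
  · exact fun a b => ciSup_le fun q => (q.2.mul a b).trans
      (mul_le_mul (le a q) (le b q) (q.2.nonneg _) (nn a))
  · exact fun c a => ciSup_le fun q => (q.2.smul c a).trans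
      (mul_le_mul_of_nonneg_left (le a q) (norm_nonneg _))
  · exact ciSup_le fun q => q.2.one
  · exact fun x => ciSup_le fun q => q.2.gen x

end

open UniformSpace in
lemma completion_step {X : Type} [NormedAddCommGroup X] [NormedSpace ℂ X]
    {S : Type} [SeminormedCommRing S] [NormedAlgebra ℂ S] (j : X →ₗ[ℂ] S)
    (h1 : ‖(1 : S)‖ = 1) (hj : ∀ x, ‖j x‖ ≤ ‖x‖)
    (hgen : Algebra.adjoin ℂ (Set.range j) = ⊤)
    (hlift : ∀ (A : Type) (_ : NormedCommRing A) (_ : NormedAlgebra ℂ A)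
      (_ : NormOneClass A) (F : X →ₗ[ℂ] A), (∀ x : X, ‖F x‖ ≤ ‖x‖) →
        ∃ G : S →ₐ[ℂ] A, (∀ s, ‖G s‖ ≤ ‖s‖) ∧ ∀ x, G (j x) = F x)
    (hinj : ∀ s : S, ‖s‖ = 0 → s = 0) :
    ∃ (SbX : Type) (_ : NormedCommRing SbX) (_ : NormedAlgebra ℂ SbX)
      (_ : NormOneClass SbX) (_ : CompleteSpace SbX) (ι : X →ₗ[ℂ] SbX),
      (∀ x : X, ‖ι x‖ ≤ ‖x‖) ∧
      (∀ (A : Type) (_ : NormedCommRing A) (_ : NormedAlgebra ℂ A)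
          (_ : NormOneClass A) (_ : CompleteSpace A) (F : X →ₗ[ℂ] A),
        (∀ x : X, ‖F x‖ ≤ ‖x‖) →
        ∃! Ftilde : SbX →ₐ[ℂ] A,
          (∀ a : SbX, ‖Ftilde a‖ ≤ ‖a‖) ∧ ∀ x : X, Ftilde (ι x) = F x) ∧
      Dense (Algebra.adjoin ℂ (Set.range ι) : Set SbX) ∧
      ∃ g : S →ₐ[ℂ] SbX, (∀ x : X, g (j x) = ι x) ∧ Function.Injective g := by
  let g : S →ₐ[ℂ] Completion S :=
    { (Completion.coeRingHom : S →+* Completion S) with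
      commutes' := fun r => by
        rw [Algebra.algebraMap_eq_smul_one, Algebra.algebraMap_eq_smul_one]
        exact (Completion.coe_smul r (1 : S)) }
  have hg : ∀ s, g s = (s : Completion S) := fun s => rfl
  have hadj : (Algebra.adjoin ℂ (Set.range (g.toLinearMap ∘ₗ j)) : Subalgebra ℂ (Completion S))
      = g.range := by
    rw [LinearMap.coe_comp, Set.range_comp]
    change Algebra.adjoin ℂ (g '' _) = _
    rw [Algebra.adjoin_image, hgen, Algebra.map_top]
  refine ⟨Completion S, inferInstance, inferInstance, ⟨?_⟩, inferInstance,
    g.toLinearMap ∘ₗ j, ?_, ?_, ?_, g, fun x => rfl, ?_⟩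
  · rw [← Completion.coe_one, Completion.norm_coe, h1]
  · intro x
    change ‖((j x : S) : Completion S)‖ ≤ _
    rw [Completion.norm_coe]
    exact hj x
  · intro A _ _ _ _ F hF
    obtain ⟨G, hGn, hG⟩ := hlift A _ _ inferInstance F hF
    have hGc : Continuous (G : S →+* A) :=
      AddMonoidHomClass.continuous_of_bound (G : S →+* A) 1 (by simpa using hGn)
    let H := Completion.extensionHom (G : S →+* A) hGc
    have hH : ∀ s : S, H (s : Completion S) = G s := fun s =>
      Completion.extensionHom_coe (G : S →+* A) hGc s
    have hHc : Continuous H := Completion.continuous_extension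
    let H' : Completion S →ₐ[ℂ] A :=
      { H with
        commutes' := fun r => by
          have : algebraMap ℂ (Completion S) r = ((algebraMap ℂ S r : S) : Completion S) :=
            (g.commutes r).symm
          change H _ = _
          rw [this, hH, G.commutes] }
    have hH' : ∀ s : S, H' (s : Completion S) = G s := hH
    refine ⟨H', ⟨?_, ?_⟩, ?_⟩
    · intro a
      induction a using Completion.induction_on with
      | hp => exact isClosed_le (continuous_norm.comp hHc) continuous_norm
      | ih a => rw [hH', Completion.norm_coe]; exact hGn a
    · intro x
      exact (hH' (j x)).trans (hG x)
    · rintro K ⟨hKn, hK⟩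
      have hKc : Continuous K :=
        AddMonoidHomClass.continuous_of_bound K 1 (by simpa using hKn)
      have hKG : K.comp g = G := by
        refine AlgHom.ext_of_adjoin_eq_top hgen ?_
        rintro _ ⟨x, rfl⟩
        exact (hK x).trans (hG x).symm
      refine AlgHom.ext fun a => ?_
      induction a using Completion.induction_on with
      | hp => exact isClosed_eq hKc hHc
      | ih a => rw [hH', ← hKG]; rfl
  · rw [hadj]
    exact Completion.denseRange_coe
  · rw [injective_iff_map_eq_zero]
    intro s hs
    apply hinj
    rw [← Completion.norm_coe s, ← hg, hs, norm_zero]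

/-- Nonzero elements are detected by contractive functionals. -/
lemma exists_functional {X : Type} [NormedAddCommGroup X] [NormedSpace ℂ X]
    {κ : Type} (b : Module.Basis κ ℂ X) (P : MvPolynomial κ ℂ) (hP : P ≠ 0) :
    ∃ f : X →ₗ[ℂ] ℂ, (∀ x, ‖f x‖ ≤ ‖x‖) ∧ MvPolynomial.eval (fun i => f (b i)) P ≠ 0 := by
  classical
  have hdual : ∀ i, ∃ f : StrongDual ℂ X, ∀ k ∈ P.vars, f (b k) = if k = i then 1 else 0 := by
    intro i
    let W : Submodule ℂ X := Submodule.span ℂ (b '' (P.vars : Set κ))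
    haveI : FiniteDimensional ℂ W :=
      FiniteDimensional.span_of_finite ℂ (P.vars.finite_toSet.image b)
    obtain ⟨f, hf, -⟩ := exists_extension_norm_eq W
      (LinearMap.toContinuousLinearMap ((b.coord i).comp W.subtype))
    refine ⟨f, fun k hk => ?_⟩
    have := hf ⟨b k, Submodule.subset_span ⟨k, hk, rfl⟩⟩
    simpa [Finsupp.single_apply] using this
  choose φ hφ using hdual
  have hMnn : 0 ≤ ∑ i ∈ P.vars, ‖φ i‖ := Finset.sum_nonneg fun i _ => norm_nonneg _
  set M : ℝ := 1 + ∑ i ∈ P.vars, ‖φ i‖ with hM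
  have hMpos : 0 < M := by linarith
  have hex : ∃ c : κ → ℂ, (∀ i, ‖c i‖ ≤ M⁻¹) ∧ MvPolynomial.eval c P ≠ 0 := by
    by_contra! hcon
    apply hP
    refine MvPolynomial.funext_set (fun _ : κ => Metric.closedBall (0 : ℂ) M⁻¹) ?_ ?_
    · intro _
      refine infinite_of_mem_nhds (0 : ℂ) (Metric.closedBall_mem_nhds _ (inv_pos.2 hMpos))
    · intro c hc
      rw [map_zero]
      exact hcon c fun i => by simpa using hc i trivial
  obtain ⟨c, hc, hcP⟩ := hex
  refine ⟨((∑ i ∈ P.vars, c i • φ i : StrongDual ℂ X) : X →ₗ[ℂ] ℂ), ?_, ?_⟩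
  · intro x
    have hn : ‖∑ i ∈ P.vars, c i • φ i‖ ≤ 1 := by
      calc ‖∑ i ∈ P.vars, c i • φ i‖ ≤ ∑ i ∈ P.vars, ‖c i • φ i‖ := norm_sum_le _ _
        _ ≤ ∑ i ∈ P.vars, M⁻¹ * ‖φ i‖ := by
          refine Finset.sum_le_sum fun i _ => ?_
          rw [norm_smul]
          exact mul_le_mul_of_nonneg_right (hc i) (norm_nonneg _)
        _ = M⁻¹ * ∑ i ∈ P.vars, ‖φ i‖ := by rw [Finset.mul_sum]
        _ ≤ M⁻¹ * M := mul_le_mul_of_nonneg_left (by linarith) (inv_pos.2 hMpos).le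
        _ = 1 := inv_mul_cancel₀ hMpos.ne'
    exact (ContinuousLinearMap.le_opNorm _ x).trans
      (mul_le_of_le_one_left (norm_nonneg _) hn)
  · convert hcP using 1
    refine MvPolynomial.eval₂Hom_congr' rfl (fun k hk _ => ?_) rfl
    have h2 : ∀ i ∈ P.vars, c i * φ i (b k) = if k = i then c i else 0 := by
      intro i _
      rw [hφ i k hk]
      split_ifs <;> simp
    simp only [ContinuousLinearMap.coe_coe, ContinuousLinearMap.sum_apply,
      ContinuousLinearMap.smul_apply, smul_eq_mul]
    rw [Finset.sum_congr rfl h2]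
    simp [hk]

lemma generic {X : Type} [NormedAddCommGroup X] [NormedSpace ℂ X]
    {S : Type} [CommRing S] [Algebra ℂ S] (j : X →ₗ[ℂ] S)
    (hgen : Algebra.adjoin ℂ (Set.range j) = ⊤)
    (hlift : ∀ (A : Type) (_ : CommRing A) (_ : Algebra ℂ A) (F : X →ₗ[ℂ] A),
        ∃ G : S →ₐ[ℂ] A, ∀ x, G (j x) = F x) :
    ∃ (SbX : Type) (_ : NormedCommRing SbX) (_ : NormedAlgebra ℂ SbX)
      (_ : NormOneClass SbX) (_ : CompleteSpace SbX) (ι : X →ₗ[ℂ] SbX),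
      (∀ x : X, ‖ι x‖ ≤ ‖x‖) ∧
      (∀ (A : Type) (_ : NormedCommRing A) (_ : NormedAlgebra ℂ A)
          (_ : NormOneClass A) (_ : CompleteSpace A) (F : X →ₗ[ℂ] A),
        (∀ x : X, ‖F x‖ ≤ ‖x‖) →
        ∃! Ftilde : SbX →ₐ[ℂ] A,
          (∀ a : SbX, ‖Ftilde a‖ ≤ ‖a‖) ∧ ∀ x : X, Ftilde (ι x) = F x) ∧
      Dense (Algebra.adjoin ℂ (Set.range ι) : Set SbX) ∧
      ∃ g : S →ₐ[ℂ] SbX, (∀ x : X, g (j x) = ι x) ∧ Function.Injective g := by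
  obtain ⟨G₀, hG₀⟩ := hlift ℂ _ inferInstance 0
  have hq₀ := adm_of_hom j G₀ (by intro x; rw [hG₀]; simp)
  obtain ⟨p, hp, hmax⟩ := exists_max_adm j hgen _ hq₀
  have hneg : ∀ s, p (-s) ≤ p s := fun s => by simpa using hp.smul (-1) s
  let rs : RingSeminorm S :=
    { toFun := p
      map_zero' := hp.zero
      add_le' := hp.add
      neg' := fun s => le_antisymm (hneg s) (by simpa using hneg (-s))
      mul_le' := hp.mul }
  letI : SeminormedCommRing S :=
    { rs.toSeminormedRing with mul_comm := mul_comm }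
  letI : NormedAlgebra ℂ S := { ‹Algebra ℂ S› with norm_smul_le := hp.smul }
  refine completion_step j ?_ hp.gen hgen ?_ ?_
  · exact le_antisymm hp.one (show 1 ≤ p 1 by simpa using hmax _ hq₀ 1)
  · intro A _ _ _ F hF
    obtain ⟨G, hG⟩ := hlift A _ inferInstance F
    exact ⟨G, fun s => hmax _ (adm_of_hom j G (by intro x; rw [hG]; exact hF x)) s, hG⟩
  · intro s hs
    replace hs : p s = 0 := hs
    let b := Module.Basis.ofVectorSpace ℂ X
    have hsurj : (MvPolynomial.aeval (R := ℂ) fun i => j (b i)).range = ⊤ := by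
      rw [eq_top_iff, ← hgen, Algebra.adjoin_le_iff]
      rintro _ ⟨x, rfl⟩
      rw [← b.linearCombination_repr x, Finsupp.linearCombination_apply, Finsupp.sum, map_sum]
      refine Subalgebra.sum_mem _ fun i _ => ?_
      rw [map_smul]
      exact Subalgebra.smul_mem _ ((AlgHom.mem_range _).2 ⟨MvPolynomial.X i, by simp⟩) _
    obtain ⟨P, rfl⟩ : s ∈ (MvPolynomial.aeval (R := ℂ) fun i => j (b i)).range := by
      rw [hsurj]; trivial
    by_cases hP : P = 0
    · rw [hP]; exact map_zero _
    exfalso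
    obtain ⟨f, hf, hfP⟩ := exists_functional b P hP
    obtain ⟨G, hG⟩ := hlift ℂ _ inferInstance f
    have h := hmax _ (adm_of_hom j G (by intro x; rw [hG]; exact hf x))
      (MvPolynomial.aeval (R := ℂ) (fun i => j (b i)) P)
    have hs' : p (MvPolynomial.aeval (R := ℂ) (fun i => j (b i)) P) = 0 := hs
    rw [hs'] at h
    have h0 : G (MvPolynomial.aeval (R := ℂ) (fun i => j (b i)) P) = 0 :=
      norm_le_zero_iff.1 h
    apply hfP
    rw [← h0, ← AlgHom.comp_apply, MvPolynomial.comp_aeval, ← MvPolynomial.coe_aeval_eq_eval]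
    simp only [hG]
    rfl

lemma symm_lift {X : Type} [AddCommGroup X] [Module ℂ X] (A : Type) [CommRing A] [Algebra ℂ A]
    (F : X →ₗ[ℂ] A) : ∃ G : SymmAlgebra X →ₐ[ℂ] A, ∀ x, G (SymmAlgebra.ι X x) = F x := by
  refine ⟨RingQuot.liftAlgHom ℂ ⟨TensorAlgebra.lift ℂ F, ?_⟩, fun x => ?_⟩
  · rintro _ _ ⟨a, b⟩
    rw [map_mul, map_mul, mul_comm]
  · simp [SymmAlgebra.ι]

lemma symm_gen (X : Type) [AddCommGroup X] [Module ℂ X] :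
    Algebra.adjoin ℂ (Set.range (SymmAlgebra.ι X)) = ⊤ := by
  have h : Set.range (SymmAlgebra.ι X)
      = RingQuot.mkAlgHom ℂ (SymRel X) '' Set.range (TensorAlgebra.ι ℂ) := by
    rw [← Set.range_comp]; rfl
  rw [h, Algebra.adjoin_image, TensorAlgebra.adjoin_range_ι, Algebra.map_top]
  exact (AlgHom.range_eq_top _).2 (RingQuot.mkAlgHom_surjective ℂ _)

end BanachSym

/-- **Existence of the Banach symmetric algebra** (Baez, Lemma 2).
Given a complex Banach space `X`, there is a commutative unital complex Banach
algebra `S_bX` together with a contraction `ι : X → S_bX` such that: for every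
commutative unital complex Banach algebra `A` and every contraction `F : X → A`
there is a unique contractive unital algebra homomorphism `F̃ : S_bX → A` with
`F = F̃ ∘ ι`; moreover the unital subalgebra generated by `ι(X)` is dense in
`S_bX`, and the canonical algebra homomorphism from the symmetric algebra `SX`
to `S_bX` extending `ι` is injective. -/
theorem exists_banach_symmetric_algebra
    (X : Type) [NormedAddCommGroup X] [NormedSpace ℂ X] [CompleteSpace X] :
    ∃ (SbX : Type) (_ : NormedCommRing SbX) (_ : NormedAlgebra ℂ SbX)
      (_ : NormOneClass SbX) (_ : CompleteSpace SbX) (ι : X →ₗ[ℂ] SbX),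
      (∀ x : X, ‖ι x‖ ≤ ‖x‖) ∧
      (∀ (A : Type) (_ : NormedCommRing A) (_ : NormedAlgebra ℂ A)
          (_ : NormOneClass A) (_ : CompleteSpace A) (F : X →ₗ[ℂ] A),
        (∀ x : X, ‖F x‖ ≤ ‖x‖) →
        ∃! Ftilde : SbX →ₐ[ℂ] A,
          (∀ a : SbX, ‖Ftilde a‖ ≤ ‖a‖) ∧ ∀ x : X, Ftilde (ι x) = F x) ∧
      Dense (Algebra.adjoin ℂ (Set.range ι) : Set SbX) ∧
      ∃ g : SymmAlgebra X →ₐ[ℂ] SbX,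
        (∀ x : X, g (SymmAlgebra.ι X x) = ι x) ∧ Function.Injective g := by
  exact BanachSym.generic (SymmAlgebra.ι X) (BanachSym.symm_gen X)
    (fun A _ _ F => BanachSym.symm_lift A F)

end
end

section
/- Let X be a complex Banach space equipped with a conjugation κ. Then there exists a commutative unital C*-algebra S_cX together with a *-contraction ι : X → S_cX such that: (i) for every commutative unital C*-algebra A and every *-contraction F : X → A, there is a unique unital *-homomorphism F̃ : S_cX → A with F = F̃ ∘ ι; and (ii) the unital *-subalgebra of S_cX generated by ι(X) is dense in S_cX, and the canonical unital algebra homomorphism from the symmetric algebra SX to S_cX extending ι is injective. -/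
noncomputable section

/-- The space of contractive functionals that intertwine `κ` with complex conjugation. -/
def conjBall {X : Type} [NormedAddCommGroup X] [NormedSpace ℂ X] (κ : X → X) :
    Set (WeakDual ℂ X) :=
  {φ | (∀ x, ‖φ x‖ ≤ ‖x‖) ∧ ∀ x, φ (κ x) = star (φ x)}

lemma isCompact_conjBall {X : Type} [NormedAddCommGroup X] [NormedSpace ℂ X] (κ : X → X) :
    IsCompact (conjBall κ) := by
  refine (WeakDual.isCompact_closedBall (𝕜 := ℂ) (E := X) 0 1).of_isClosed_subset ?_ ?_
  · have : conjBall κ = (⋂ x, {φ : WeakDual ℂ X | ‖φ x‖ ≤ ‖x‖}) ∩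
        ⋂ x, {φ : WeakDual ℂ X | φ (κ x) = star (φ x)} := by
      ext φ; simp [conjBall]
    rw [this]
    refine (isClosed_iInter fun x => ?_).inter (isClosed_iInter fun x => ?_)
    · exact isClosed_le (WeakDual.eval_continuous x).norm continuous_const
    · exact isClosed_eq (WeakDual.eval_continuous _) (WeakDual.eval_continuous x).star
  · intro φ hφ
    simp only [Set.mem_preimage, mem_closedBall_zero_iff]
    refine ContinuousLinearMap.opNorm_le_bound _ zero_le_one fun x => ?_
    rw [one_mul]
    exact hφ.1 x

instance {X : Type} [NormedAddCommGroup X] [NormedSpace ℂ X] (κ : X → X) :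
    CompactSpace (conjBall κ) := isCompact_iff_compactSpace.mp (isCompact_conjBall κ)

/-- Evaluation map. -/
def conjEval {X : Type} [NormedAddCommGroup X] [NormedSpace ℂ X] (κ : X → X) :
    X →ₗ[ℂ] C(conjBall κ, ℂ) where
  toFun x := ⟨fun φ => φ.1 x, (WeakDual.eval_continuous x).comp continuous_subtype_val⟩
  map_add' x y := by ext φ; exact map_add φ.1 x y
  map_smul' c x := by ext φ; exact map_smul φ.1 c x

@[simp] lemma conjEval_apply {X : Type} [NormedAddCommGroup X] [NormedSpace ℂ X] (κ : X → X)
    (x : X) (φ : conjBall κ) : conjEval κ x φ = φ.1 x := rfl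

lemma conjEval_closure {X : Type} [NormedAddCommGroup X] [NormedSpace ℂ X] (κ : X → X) :
    (StarAlgebra.adjoin ℂ (Set.range (conjEval κ))).topologicalClosure = ⊤ := by
  apply ContinuousMap.starSubalgebra_topologicalClosure_eq_top_of_separatesPoints
  intro φ ψ hne
  have : ∃ x, φ.1 x ≠ ψ.1 x := by
    by_contra! h
    exact hne (Subtype.ext (DFunLike.ext _ _ h))
  obtain ⟨x, hx⟩ := this
  exact ⟨conjEval κ x, ⟨_, StarAlgebra.subset_adjoin ℂ _ ⟨x, rfl⟩, rfl⟩, hx⟩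

lemma conjEval_dense {X : Type} [NormedAddCommGroup X] [NormedSpace ℂ X] (κ : X → X) :
    Dense (StarAlgebra.adjoin ℂ (Set.range (conjEval κ)) : Set C(conjBall κ, ℂ)) := by
  rw [dense_iff_closure_eq, ← StarSubalgebra.topologicalClosure_coe, conjEval_closure]
  rfl

lemma conjEval_universal {X : Type} [NormedAddCommGroup X] [NormedSpace ℂ X] (κ : X → X)
    (A : Type) [CommCStarAlgebra A] (F : X →ₗ[ℂ] A)
    (hF : ∀ x : X, ‖F x‖ ≤ ‖x‖) (hFκ : ∀ x : X, F (κ x) = star (F x)) :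
    ∃! Ftilde : C(conjBall κ, ℂ) →⋆ₐ[ℂ] A, ∀ x : X, Ftilde (conjEval κ x) = F x := by
  let Fc : X →L[ℂ] A := F.mkContinuous 1 (by simpa using hF)
  let m : C(WeakDual.characterSpace ℂ A, conjBall κ) :=
    { toFun := fun χ => ⟨StrongDual.toWeakDual ((WeakDual.toStrongDual χ.1).comp Fc), by
          refine ⟨fun x => ?_, fun x => ?_⟩
          · have h1 : ‖χ (F x)‖ ≤ ‖F x‖ := NonUnitalStarAlgHom.norm_apply_le χ (F x)
            exact h1.trans (hF x)
          · change χ (F (κ x)) = star (χ (F x))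
            rw [hFκ, map_star]⟩
      continuous_toFun := by
        refine Continuous.subtype_mk ?_ _
        refine WeakDual.continuous_of_continuous_eval fun x => ?_
        exact (WeakDual.eval_continuous (F x)).comp continuous_subtype_val }
  refine ⟨((gelfandStarTransform A).symm : C(WeakDual.characterSpace ℂ A, ℂ) →⋆ₐ[ℂ] A).comp
    (ContinuousMap.compStarAlgHom' ℂ ℂ m), fun x => ?_, fun G hG => ?_⟩
  · change (gelfandStarTransform A).symm ((conjEval κ x).comp m) = F x
    have : (conjEval κ x).comp m = gelfandStarTransform A (F x) := by
      ext χ; rfl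
    rw [this, StarAlgEquiv.symm_apply_apply]
  · have key : ∀ G H : C(conjBall κ, ℂ) →⋆ₐ[ℂ] A, (∀ x, G (conjEval κ x) = F x) →
        (∀ x, H (conjEval κ x) = F x) → G = H := by
      intro G H hG hH
      have hcG : Continuous G := (AddMonoidHomClass.lipschitz_of_bound_nnnorm G 1 (by simpa only [one_mul] using NonUnitalStarAlgHom.nnnorm_apply_le G)).continuous
      have hcH : Continuous H := (AddMonoidHomClass.lipschitz_of_bound_nnnorm H 1 (by simpa only [one_mul] using NonUnitalStarAlgHom.nnnorm_apply_le H)).continuous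
      refine DFunLike.coe_injective (Continuous.ext_on (conjEval_dense κ) hcG hcH ?_)
      have hle : StarAlgebra.adjoin ℂ (Set.range (conjEval κ)) ≤ StarAlgHom.equalizer G H := by
        apply StarAlgebra.adjoin_le
        rintro _ ⟨x, rfl⟩
        exact (hG x).trans (hH x).symm
      exact fun a ha => hle ha
    refine key _ _ hG fun x => ?_
    change (gelfandStarTransform A).symm ((conjEval κ x).comp m) = F x
    have : (conjEval κ x).comp m = gelfandStarTransform A (F x) := by
      ext χ; rfl
    rw [this, StarAlgEquiv.symm_apply_apply]

lemma exists_conj_dual {X : Type} [NormedAddCommGroup X] [NormedSpace ℂ X] (κ : X → X)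
    (hκ_add : ∀ x y : X, κ (x + y) = κ x + κ y)
    (hκ_smul : ∀ (c : ℂ) (x : X), κ (c • x) = (starRingEnd ℂ c) • κ x)
    (hκ_norm : ∀ x : X, ‖κ x‖ = ‖x‖)
    (hκ_invol : ∀ x : X, κ (κ x) = x)
    (ψ : StrongDual ℂ X) (hψ : ‖ψ‖ ≤ 1) :
    ∃ φ : conjBall κ, ∀ x, φ.1 x = (ψ x + star (ψ (κ x))) / 2 := by
  let L : X →ₗ[ℂ] ℂ :=
    { toFun := fun x => (ψ x + star (ψ (κ x))) / 2
      map_add' := fun x y => by simp only [hκ_add, map_add, star_add]; ring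
      map_smul' := fun c x => by
        simp only [hκ_smul, map_smul, smul_eq_mul, star_mul', RingHom.id_apply]
        simp
        ring }
  have hL : ∀ x, ‖L x‖ ≤ 1 * ‖x‖ := by
    intro x
    have h1 : ‖ψ x‖ ≤ ‖x‖ := by simpa using ψ.le_of_opNorm_le hψ x
    have h2 : ‖star (ψ (κ x))‖ ≤ ‖x‖ := by
      rw [norm_star, ← hκ_norm x]; simpa using ψ.le_of_opNorm_le hψ (κ x)
    have h3 := norm_add_le (ψ x) (star (ψ (κ x)))
    change ‖(ψ x + star (ψ (κ x))) / 2‖ ≤ 1 * ‖x‖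
    rw [norm_div, Complex.norm_two]
    linarith
  refine ⟨⟨StrongDual.toWeakDual (L.mkContinuous 1 hL), fun x => ?_, fun x => ?_⟩, fun x => rfl⟩
  · simpa using hL x
  · change (ψ (κ x) + star (ψ (κ (κ x)))) / 2 = star ((ψ x + star (ψ (κ x))) / 2)
    rw [hκ_invol, star_div₀, star_add, star_star]
    simp [add_comm]

lemma exists_dual_family {X : Type} [NormedAddCommGroup X] [NormedSpace ℂ X]
    {s : Type} [Finite s] (v : s → X) (hv : LinearIndependent ℂ v) (c : s → ℂ) :
    ∃ ψ : StrongDual ℂ X, ∀ i, ψ (v i) = c i := by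
  let B := Module.Basis.span hv
  have : FiniteDimensional ℂ (Submodule.span ℂ (Set.range v)) :=
    FiniteDimensional.span_of_finite ℂ (Set.finite_range v)
  let f := LinearMap.toContinuousLinearMap (B.constr ℂ c)
  obtain ⟨g, hg, -⟩ := exists_extension_norm_eq _ f
  refine ⟨g, fun i => ?_⟩
  have h1 := hg (B i)
  have h2 : ((B i : _) : X) = v i := congrArg Subtype.val (Module.Basis.span_apply hv i)
  rw [h2] at h1
  rw [h1]
  exact B.constr_basis ℂ c i

lemma exists_infinite_box {X : Type} [NormedAddCommGroup X] [NormedSpace ℂ X] (κ : X → X)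
    (hκ_add : ∀ x y : X, κ (x + y) = κ x + κ y)
    (hκ_smul : ∀ (c : ℂ) (x : X), κ (c • x) = (starRingEnd ℂ c) • κ x)
    (hκ_norm : ∀ x : X, ‖κ x‖ = ‖x‖)
    (hκ_invol : ∀ x : X, κ (κ x) = x)
    {s : Type} [Fintype s] (v : s → X) (hv : LinearIndependent ℂ v) (hκv : ∀ i, κ (v i) = v i) :
    ∃ S : Set ℂ, S.Infinite ∧ ∀ c : s → ℂ, (∀ i, c i ∈ S) →
      ∃ φ : conjBall κ, ∀ i, φ.1 (v i) = c i := by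
  classical
  choose ψ hψ using fun i : s => exists_dual_family v hv (Pi.single i 1)
  let M : ℝ := ∑ i, ‖ψ i‖ + 1
  have hM : 0 < M := by positivity
  refine ⟨(fun t : ℝ => (t : ℂ)) '' Set.Icc 0 (1 / M), ?_, ?_⟩
  · exact (Set.Icc_infinite (by positivity)).image Complex.ofReal_injective.injOn
  · intro c hc
    choose t ht htc using hc
    have hn : ‖∑ i, c i • ψ i‖ ≤ 1 := by
      calc ‖∑ i, c i • ψ i‖ ≤ ∑ i, ‖c i • ψ i‖ := norm_sum_le _ _
        _ ≤ ∑ i, (1 / M) * ‖ψ i‖ := by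
            refine Finset.sum_le_sum fun i _ => ?_
            rw [norm_smul]
            refine mul_le_mul_of_nonneg_right ?_ (norm_nonneg _)
            rw [← htc i]
            simpa [abs_of_nonneg (ht i).1] using (ht i).2
        _ = (1 / M) * ∑ i, ‖ψ i‖ := by rw [Finset.mul_sum]
        _ ≤ (1 / M) * M := by
            refine mul_le_mul_of_nonneg_left ?_ (by positivity)
            simp [M]
        _ = 1 := by field_simp
    obtain ⟨φ, hφ⟩ := exists_conj_dual κ hκ_add hκ_smul hκ_norm hκ_invol _ hn
    refine ⟨φ, fun j => ?_⟩
    have h1 : (∑ i, c i • ψ i) (v j) = c j := by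
      simp [hψ, Pi.single_apply]
    rw [hφ, hκv, h1, ← htc j]
    simp

lemma exists_conj_basis {X : Type} [NormedAddCommGroup X] [NormedSpace ℂ X] (κ : X → X)
    (hκ_add : ∀ x y : X, κ (x + y) = κ x + κ y)
    (hκ_smul : ∀ (c : ℂ) (x : X), κ (c • x) = (starRingEnd ℂ c) • κ x)
    (hκ_invol : ∀ x : X, κ (κ x) = x) :
    ∃ b : Set X, (∀ x ∈ b, κ x = x) ∧ LinearIndependent ℂ ((↑) : b → X) ∧
      Submodule.span ℂ b = ⊤ := by
  obtain ⟨b, hb, hs, hl⟩ := exists_linearIndependent ℂ {x : X | κ x = x}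
  refine ⟨b, hb, hl, ?_⟩
  rw [hs, eq_top_iff]
  intro x _
  have h1 : x + κ x ∈ Submodule.span ℂ {x : X | κ x = x} :=
    Submodule.subset_span (by simp [hκ_add, hκ_invol, add_comm])
  have h2 : Complex.I • x + κ (Complex.I • x) ∈ Submodule.span ℂ {x : X | κ x = x} :=
    Submodule.subset_span (by simp only [Set.mem_setOf_eq, hκ_add, hκ_invol, add_comm])
  have h3 : x = (1 / 2 : ℂ) • (x + κ x) +
      (-Complex.I / 2) • (Complex.I • x + κ (Complex.I • x)) := by
    rw [hκ_smul, Complex.conj_I, smul_add, smul_add, smul_smul, smul_smul]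
    have e1 : -Complex.I / 2 * Complex.I = 1 / 2 := by
      linear_combination (-1 / 2 : ℂ) * Complex.I_mul_I
    have e2 : -Complex.I / 2 * -Complex.I = -(1 / 2) := by
      linear_combination (1 / 2 : ℂ) * Complex.I_mul_I
    rw [e1, e2]
    module
  rw [h3]
  exact add_mem (Submodule.smul_mem _ _ h1) (Submodule.smul_mem _ _ h2)

lemma symm_aeval_surjective {X : Type} [AddCommGroup X] [Module ℂ X] (b : Set X)
    (hb : Submodule.span ℂ b = ⊤) (y : SymmAlgebra X) :
    ∃ q : MvPolynomial b ℂ, MvPolynomial.aeval (fun i : b => SymmAlgebra.ι X i) q = y := by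
  obtain ⟨a, rfl⟩ := RingQuot.mkAlgHom_surjective ℂ (SymRel X) y
  change (RingQuot.mkAlgHom ℂ (SymRel X) a) ∈
    (MvPolynomial.aeval (R := ℂ) (fun i : b => SymmAlgebra.ι X i)).range
  induction a using TensorAlgebra.induction with
  | algebraMap r => rw [AlgHom.commutes]; exact Subalgebra.algebraMap_mem _ r
  | ι x =>
    have hle : Submodule.span ℂ b ≤ (Subalgebra.toSubmodule
        (MvPolynomial.aeval (R := ℂ) (fun i : b => SymmAlgebra.ι X i)).range).comap
        (SymmAlgebra.ι X) := by
      rw [Submodule.span_le]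
      intro x hx
      exact ⟨MvPolynomial.X ⟨x, hx⟩, by simp⟩
    exact hle (hb ▸ Submodule.mem_top)
  | mul x y hx hy => rw [map_mul]; exact mul_mem hx hy
  | add x y hx hy => rw [map_add]; exact add_mem hx hy

lemma conjEval_symm_injective {X : Type} [NormedAddCommGroup X] [NormedSpace ℂ X] (κ : X → X)
    (hκ_add : ∀ x y : X, κ (x + y) = κ x + κ y)
    (hκ_smul : ∀ (c : ℂ) (x : X), κ (c • x) = (starRingEnd ℂ c) • κ x)
    (hκ_norm : ∀ x : X, ‖κ x‖ = ‖x‖)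
    (hκ_invol : ∀ x : X, κ (κ x) = x)
    (g : SymmAlgebra X →ₐ[ℂ] C(conjBall κ, ℂ))
    (hg : ∀ x : X, g (SymmAlgebra.ι X x) = conjEval κ x) : Function.Injective g := by
  rw [injective_iff_map_eq_zero]
  intro y hy
  obtain ⟨b, hbκ, hbl, hbs⟩ := exists_conj_basis κ hκ_add hκ_smul hκ_invol
  obtain ⟨q, rfl⟩ := symm_aeval_surjective b hbs y
  obtain ⟨s, p, rfl⟩ := MvPolynomial.exists_finset_rename q
  suffices h : p = 0 by rw [h]; simp
  obtain ⟨S, hS, hbox⟩ := exists_infinite_box κ hκ_add hκ_smul hκ_norm hκ_invol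
    (fun i : s => ((i : b) : X)) (hbl.comp _ Subtype.val_injective) (fun i => hbκ _ i.1.2)
  refine MvPolynomial.funext_set (fun _ => S) (fun _ => hS) fun c hc => ?_
  obtain ⟨φ, hφ⟩ := hbox c fun i => hc i (Set.mem_univ i)
  have h1 : ∀ r : MvPolynomial b ℂ,
      (g (MvPolynomial.aeval (fun i : b => SymmAlgebra.ι X i) r)) φ =
        MvPolynomial.aeval (fun i : b => φ.1 (i : X)) r := by
    intro r
    induction r using MvPolynomial.induction_on with
    | C a =>
      rw [MvPolynomial.aeval_C, MvPolynomial.aeval_C, AlgHom.commutes]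
      rfl
    | add p q hp hq => rw [map_add, map_add, map_add, ContinuousMap.add_apply, hp, hq]
    | mul_X p i hp =>
      rw [map_mul, map_mul, map_mul, ContinuousMap.mul_apply, hp, MvPolynomial.aeval_X,
        MvPolynomial.aeval_X, hg, conjEval_apply]
  have h2 := h1 (MvPolynomial.rename Subtype.val p)
  rw [hy, MvPolynomial.aeval_rename] at h2
  have h3 : (fun i : b => φ.1 (i : X)) ∘ (Subtype.val : s → b) = c := funext hφ
  rw [h3] at h2
  rw [map_zero, ← MvPolynomial.coe_aeval_eq_eval]
  exact h2.symm

lemma exists_symm_lift {X : Type} [AddCommGroup X] [Module ℂ X] {A : Type} [CommRing A]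
    [Algebra ℂ A] (f : X →ₗ[ℂ] A) :
    ∃ g : SymmAlgebra X →ₐ[ℂ] A, ∀ x : X, g (SymmAlgebra.ι X x) = f x := by
  refine ⟨RingQuot.liftAlgHom ℂ ⟨TensorAlgebra.lift ℂ f, ?_⟩, fun x => ?_⟩
  · rintro _ _ ⟨a, b⟩
    rw [map_mul, map_mul, mul_comm]
  · simp [SymmAlgebra.ι]

/-- **Existence of the C* symmetric algebra** (Baez, Lemma 3').
Given a complex Banach space `X` with a conjugation `κ` (a norm-preserving
conjugate-linear involution), there is a commutative unital C*-algebra `S_cX`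
together with a `*`-contraction `ι : X → S_cX` such that: for every commutative
unital C*-algebra `A` and every `*`-contraction `F : X → A` there is a unique
unital `*`-homomorphism `F̃ : S_cX → A` with `F = F̃ ∘ ι`; moreover the unital
`*`-subalgebra generated by `ι(X)` is dense in `S_cX`, and the canonical
algebra homomorphism from the symmetric algebra `SX` to `S_cX` extending `ι`
is injective. -/
theorem exists_cstar_symmetric_algebra
    (X : Type) [NormedAddCommGroup X] [NormedSpace ℂ X] [CompleteSpace X]
    (κ : X → X)
    (hκ_add : ∀ x y : X, κ (x + y) = κ x + κ y)
    (hκ_smul : ∀ (c : ℂ) (x : X), κ (c • x) = (starRingEnd ℂ c) • κ x)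
    (hκ_norm : ∀ x : X, ‖κ x‖ = ‖x‖)
    (hκ_invol : ∀ x : X, κ (κ x) = x) :
    ∃ (ScX : Type) (_ : NormedCommRing ScX) (_ : StarRing ScX) (_ : CStarRing ScX)
      (_ : NormedAlgebra ℂ ScX) (_ : StarModule ℂ ScX) (_ : CompleteSpace ScX)
      (ι : X →ₗ[ℂ] ScX),
      (∀ x : X, ‖ι x‖ ≤ ‖x‖) ∧
      (∀ x : X, ι (κ x) = star (ι x)) ∧
      (∀ (A : Type) (_ : NormedCommRing A) (_ : StarRing A) (_ : CStarRing A)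
          (_ : NormedAlgebra ℂ A) (_ : StarModule ℂ A) (_ : CompleteSpace A)
          (F : X →ₗ[ℂ] A),
        (∀ x : X, ‖F x‖ ≤ ‖x‖) → (∀ x : X, F (κ x) = star (F x)) →
        ∃! Ftilde : ScX →⋆ₐ[ℂ] A, ∀ x : X, Ftilde (ι x) = F x) ∧
      Dense (StarAlgebra.adjoin ℂ (Set.range ι) : Set ScX) ∧
      ∃ g : SymmAlgebra X →ₐ[ℂ] ScX,
        (∀ x : X, g (SymmAlgebra.ι X x) = ι x) ∧ Function.Injective g := by
  obtain ⟨g, hg⟩ := exists_symm_lift (conjEval κ)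
  refine ⟨C(conjBall κ, ℂ), inferInstance, inferInstance, inferInstance, inferInstance,
    inferInstance, inferInstance, conjEval κ, fun x => ?_, fun x => ?_, ?_, conjEval_dense κ,
    g, hg, conjEval_symm_injective κ hκ_add hκ_smul hκ_norm hκ_invol g hg⟩
  · exact (ContinuousMap.norm_le _ (norm_nonneg x)).mpr fun φ => φ.2.1 x
  · ext φ
    exact φ.2.2 x
  · intro A i1 i2 i3 i4 i5 i6 F hF hFκ
    letI : CommCStarAlgebra A :=
      { i1, i2, i3, i4, i5, i6 with }
    exact conjEval_universal κ A F hF hFκ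

end
end

section
/- Let K be a compact topological space, M a Hausdorff topological space, and Z any topological space. Let γ₁, …, γ_p : K × Z → M be continuous maps. Then the set of p-tuples (x₁, …, x_p) ∈ Z^p such that the sets γ_i(K × {x_i}), for i = 1, …, p, are pairwise disjoint is an open subset of Z^p. -/
/-- **Openness of the pairwise-disjointness locus** (topological part of Baez's
Lemma 7).  Let `K` be a compact space, `M` a Hausdorff space, `Z` any
topological space, and `γ₁, …, γ_p : K × Z → M` continuous.  Then the set of
`p`-tuples `(x₁, …, x_p) ∈ Z^p` such that the compact sets `γᵢ(K × {xᵢ})` are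
pairwise disjoint is open in `Z^p` (with the product topology). -/
theorem isOpen_pairwise_disjoint_images
    {K M Z : Type} [TopologicalSpace K] [CompactSpace K]
    [TopologicalSpace M] [T2Space M] [TopologicalSpace Z]
    (p : ℕ) (γ : Fin p → K × Z → M) (hγ : ∀ i, Continuous (γ i)) :
    IsOpen {x : Fin p → Z |
      Pairwise fun i j =>
        Disjoint (Set.range fun t : K => γ i (t, x i))
          (Set.range fun t : K => γ j (t, x j))} := by
  simp only [Pairwise, Set.setOf_forall]
  refine isOpen_iInter_of_finite fun i => isOpen_iInter_of_finite fun j =>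
    isOpen_iInter_of_finite fun _ => ?_
  have hc : IsClosed {q : (K × K) × (Fin p → Z) |
      γ i (q.1.1, q.2 i) = γ j (q.1.2, q.2 j)} := by
    have hi := hγ i
    have hj := hγ j
    exact isClosed_eq (by fun_prop) (by fun_prop)
  have h := (isClosedMap_snd_of_compactSpace _ hc).isOpen_compl
  convert h using 1
  ext x
  simp only [Set.mem_setOf_eq, Set.mem_compl_iff, Set.mem_image, Set.disjoint_left,
    Set.mem_range]
  constructor
  · rintro hx ⟨⟨⟨s, t⟩, y⟩, hy, rfl⟩
    exact hx ⟨s, rfl⟩ ⟨t, hy.symm⟩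
  · rintro hx _ ⟨s, rfl⟩ ⟨t, ht⟩
    exact hx ⟨((s, t), x), ht.symm, rfl⟩
end

section
/- Let n ≥ 1 and let Q : ℝⁿ × ℝⁿ → ℂ be a symmetric ℝ-bilinear form such that Re Q(x, x) < 0 for all nonzero x ∈ ℝⁿ. Then the functions x ↦ exp(Q(x, x)) and, for each v ∈ ℝⁿ, x ↦ exp(Q(v, x) + Q(x, x)) are Lebesgue-integrable on ℝⁿ; moreover ∫_{ℝⁿ} exp(Q(x, x)) dx ≠ 0, and for every v ∈ ℝⁿ, ∫_{ℝⁿ} exp(Q(v, x)) · exp(Q(x, x)) dx = exp(−Q(v, v)/4) · ∫_{ℝⁿ} exp(Q(x, x)) dx. -/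
open MeasureTheory
open scoped MatrixOrder Matrix

lemma exists_simul_diag (n : ℕ) (A M : Matrix (Fin n) (Fin n) ℝ) (hA : A.PosDef)
    (hM : Mᵀ = M) : ∃ (P : Matrix (Fin n) (Fin n) ℝ) (d : Fin n → ℝ), P.det ≠ 0 ∧
      Pᵀ * A * P = 1 ∧ Pᵀ * M * P = Matrix.diagonal d := by
  obtain ⟨B, hB⟩ := CStarAlgebra.nonneg_iff_eq_star_mul_self.mp hA.posSemidef.nonneg
  have hdet : IsUnit B.det := by
    have h := hA.det_pos.ne'
    rw [hB, Matrix.det_mul] at h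
    exact (right_ne_zero_of_mul h).isUnit
  have hstar : star B = Bᵀ := by simp [Matrix.star_eq_conjTranspose]
  rw [hstar] at hB
  have hC : ((B⁻¹)ᵀ * M * B⁻¹).IsHermitian := by
    simp [Matrix.IsHermitian, Matrix.conjTranspose_eq_transpose_of_trivial,
      Matrix.transpose_mul, hM, Matrix.mul_assoc]
  have hsp := hC.conjStarAlgAut_star_eigenvectorUnitary
  have hU1 := Unitary.star_mul_self_of_mem hC.eigenvectorUnitary.2
  set U : Matrix (Fin n) (Fin n) ℝ := hC.eigenvectorUnitary.1 with hU
  rw [Unitary.conjStarAlgAut_star_apply] at hsp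
  have hs : star U = Uᵀ := by simp [Matrix.star_eq_conjTranspose]
  rw [← hU, hs] at hsp
  rw [hs] at hU1
  have hBB : B * B⁻¹ = 1 := Matrix.mul_nonsing_inv _ hdet
  have hBB' : (B⁻¹)ᵀ * Bᵀ = 1 := by rw [← Matrix.transpose_mul, hBB, Matrix.transpose_one]
  refine ⟨B⁻¹ * U, hC.eigenvalues, ?_, ?_, ?_⟩
  · intro h
    have h1 := congrArg Matrix.det hU1
    have h2 := congrArg Matrix.det hBB
    simp only [Matrix.det_mul, Matrix.det_one] at h h1 h2
    rcases mul_eq_zero.mp h with h | h <;> simp [h] at h1 h2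
  · calc (B⁻¹ * U)ᵀ * A * (B⁻¹ * U) = Uᵀ * ((B⁻¹)ᵀ * Bᵀ) * (B * B⁻¹) * U := by
          rw [hB, Matrix.transpose_mul]; simp only [Matrix.mul_assoc]
      _ = 1 := by rw [hBB, hBB', mul_one, mul_one, hU1]
  · rw [Matrix.transpose_mul]
    simpa [Matrix.mul_assoc, Function.comp_def] using hsp

/-- **Gaussian expectation of exponentials** (Baez, Introduction).  Let `Q` be a
symmetric `ℝ`-bilinear complex-valued form on `ℝⁿ` with `Re Q(x,x) < 0` for all
`x ≠ 0`.  Then `x ↦ exp(Q(x,x))` and `x ↦ exp(Q(v,x) + Q(x,x))` are Lebesgue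
integrable, `∫ exp(Q(x,x)) dx ≠ 0`, and for every `v`,
`∫ exp(Q(v,x)) exp(Q(x,x)) dx = exp(-Q(v,v)/4) ∫ exp(Q(x,x)) dx`. -/
theorem gaussian_expectation_of_exponential
    (n : ℕ) (hn : 1 ≤ n)
    (Q : (Fin n → ℝ) →ₗ[ℝ] (Fin n → ℝ) →ₗ[ℝ] ℂ)
    (hQ_symm : ∀ x y : Fin n → ℝ, Q x y = Q y x)
    (hQ_neg : ∀ x : Fin n → ℝ, x ≠ 0 → (Q x x).re < 0) :
    Integrable (fun x : Fin n → ℝ => Complex.exp (Q x x)) ∧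
    (∀ v : Fin n → ℝ,
      Integrable (fun x : Fin n → ℝ => Complex.exp (Q v x + Q x x))) ∧
    (∫ x : Fin n → ℝ, Complex.exp (Q x x)) ≠ 0 ∧
    ∀ v : Fin n → ℝ,
      (∫ x : Fin n → ℝ, Complex.exp (Q v x) * Complex.exp (Q x x)) =
        Complex.exp (-(Q v v) / 4) * ∫ x : Fin n → ℝ, Complex.exp (Q x x) := by
  have hsq : ∀ v x : Fin n → ℝ, Complex.exp (Q v x + Q x x) =
      Complex.exp (-(Q v v) / 4) *
        Complex.exp (Q (x + (1/2 : ℝ) • v) (x + (1/2 : ℝ) • v)) := by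
    intro v x
    rw [← Complex.exp_add]
    congr 1
    simp only [map_add, LinearMap.add_apply, map_smul, LinearMap.smul_apply, hQ_symm x v,
      Complex.real_smul]
    push_cast
    ring
  set R : (Fin n → ℝ) →ₗ[ℝ] (Fin n → ℝ) →ₗ[ℝ] ℝ := Q.compr₂ (-Complex.reLm) with hR
  set I : (Fin n → ℝ) →ₗ[ℝ] (Fin n → ℝ) →ₗ[ℝ] ℝ := Q.compr₂ (Complex.imLm) with hI
  have hRa : ∀ x y, R x y = -(Q x y).re := fun x y => by simp [hR]
  have hIa : ∀ x y, I x y = (Q x y).im := fun x y => by simp [hI]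
  set A := LinearMap.toMatrix₂' ℝ R with hAdef
  set M := LinearMap.toMatrix₂' ℝ I with hMdef
  have hRA : ∀ x y, R x y = x ⬝ᵥ (A *ᵥ y) := fun x y => by
    rw [← Matrix.toLinearMap₂'_apply', hAdef, Matrix.toLinearMap₂'_toMatrix']
  have hIM : ∀ x y, I x y = x ⬝ᵥ (M *ᵥ y) := fun x y => by
    rw [← Matrix.toLinearMap₂'_apply', hMdef, Matrix.toLinearMap₂'_toMatrix']
  have hMs : Mᵀ = M := by
    ext i j
    simp [hMdef, LinearMap.toMatrix₂'_apply, hIa, hQ_symm (Pi.single j 1)]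
  have hAs : Aᵀ = A := by
    ext i j
    simp [hAdef, LinearMap.toMatrix₂'_apply, hRa, hQ_symm (Pi.single j 1)]
  have hA : A.PosDef := by
    refine Matrix.PosDef.of_dotProduct_mulVec_pos ?_ ?_
    · rw [Matrix.IsHermitian, Matrix.conjTranspose_eq_transpose_of_trivial, hAs]
    · intro x hx
      rw [star_trivial, ← hRA, hRa]
      linarith [hQ_neg x hx]
  obtain ⟨P, d, hP, hPA, hPM⟩ := exists_simul_diag n A M hA hMs
  have key : ∀ (N : Matrix (Fin n) (Fin n) ℝ) (y : Fin n → ℝ),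
      (P *ᵥ y) ⬝ᵥ (N *ᵥ (P *ᵥ y)) = y ⬝ᵥ ((Pᵀ * N * P) *ᵥ y) := by
    intro N y
    rw [← Matrix.mulVec_mulVec, ← Matrix.mulVec_mulVec, Matrix.dotProduct_mulVec y,
      Matrix.vecMul_transpose]
  have hQP : ∀ y, Q (P *ᵥ y) (P *ᵥ y) =
      -∑ i, (1 - d i * Complex.I) * (y i : ℂ) ^ 2 + ∑ i, (0 : ℂ) * (y i : ℂ) := by
    intro y
    have h1 := hRA (P *ᵥ y) (P *ᵥ y)
    have h2 := hIM (P *ᵥ y) (P *ᵥ y)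
    rw [key, hPA, hRa, Matrix.one_mulVec] at h1
    rw [key, hPM, hIa] at h2
    rw [← Complex.re_add_im (Q (P *ᵥ y) (P *ᵥ y)), h2, ← neg_neg (Q _ _).re, h1]
    simp only [dotProduct, Matrix.mulVec_diagonal]
    push_cast
    rw [Finset.sum_mul, ← Finset.sum_neg_distrib, ← Finset.sum_neg_distrib,
      ← Finset.sum_add_distrib, ← Finset.sum_add_distrib]
    refine Finset.sum_congr rfl fun i _ => ?_
    ring
  have hb : ∀ i, 0 < (1 - d i * Complex.I : ℂ).re := fun i => by simp
  have hint := GaussianFourier.integrable_cexp_neg_sum_mul_add hb (fun _ => 0)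
  have hval := GaussianFourier.integral_cexp_neg_sum_mul_add hb (fun _ => 0)
  simp only [← hQP] at hint hval
  have hmap := Real.map_matrix_volume_pi_eq_smul_volume_pi hP
  have hc0 : ENNReal.ofReal |(P.det)⁻¹| ≠ 0 := by simpa using hP
  have hPc : Continuous (Matrix.toLin' P) := LinearMap.continuous_on_pi _
  have hQc : Continuous (fun x : Fin n → ℝ => Complex.exp (Q x x)) := by
    have h : ∀ x, Q x x = ((-(x ⬝ᵥ (A *ᵥ x)) : ℝ) : ℂ) + ((x ⬝ᵥ (M *ᵥ x) : ℝ) : ℂ) * Complex.I := by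
      intro x
      rw [← hRA, ← hIM, hRa, hIa, neg_neg, Complex.re_add_im]
    simp only [h]
    fun_prop
  have hI1 : Integrable (fun x : Fin n → ℝ => Complex.exp (Q x x)) := by
    have h := (integrable_map_measure (μ := volume) (f := Matrix.toLin' P)
      hQc.aestronglyMeasurable hPc.measurable.aemeasurable).2 hint
    rw [hmap] at h
    exact (integrable_smul_measure hc0 ENNReal.ofReal_ne_top).1 h
  refine ⟨hI1, ?_, ?_, ?_⟩
  · intro v
    simp only [hsq]
    exact (hI1.comp_add_right _).const_mul _
  · intro h0
    have h := integral_map (μ := volume) (φ := Matrix.toLin' P)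
      hPc.measurable.aemeasurable (hQc.aestronglyMeasurable)
    rw [hmap, integral_smul_measure, h0, smul_zero] at h
    simp only [Matrix.toLin'_apply] at h
    rw [hval] at h
    refine Finset.prod_ne_zero_iff.2 (fun i _ => ?_) h.symm
    have hbi : (1 - d i * Complex.I : ℂ) ≠ 0 := fun hh => by
      have := hb i
      rw [hh] at this
      simp at this
    refine mul_ne_zero ?_ (Complex.exp_ne_zero _)
    rw [Complex.cpow_def_of_ne_zero
      (div_ne_zero (Complex.ofReal_ne_zero.2 Real.pi_ne_zero) hbi)]
    exact Complex.exp_ne_zero _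
  · intro v
    simp only [← Complex.exp_add]
    simp only [hsq]
    rw [integral_const_mul,
      integral_add_right_eq_self (fun x : Fin n → ℝ => Complex.exp (Q x x))]
end
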